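/- arXiv:quant-ph/0311070 — 5 statements merged into one kernel-verified Lean document; each statement's English description precedes it below -/
import Mathlib

section
/- Let $(p_i)_{i\in I}$ be a directed family of partial states of the quantum logic of a complex Hilbert space $H$, where the family is directed with respect to the pointwise order ($p \le q$ iff $p(K) \le q(K)$ for every closed subspace $K$). Then the pointwise supremum $p$ defined by $p(K) = \sup_{i\in I} p_i(K)$ is again a partial state (in particular it is countably additive on sequences of mutually orthogonal closed subspaces), and $p$ is the least upper bound of $(p_i)_{i\in I}$ in the pointwise order. Hence the partially ordered set of partial states is directed complete. -/
open scoped InnerProductSpace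

/-- A partial state (subprobability measure) of the quantum logic of a complex
Hilbert space `H`: a function on (closed) subspaces with values in `[0,1]`,
vanishing on `{0}`, at most `1` on `H`, and countably additive on sequences of
mutually orthogonal closed subspaces, where the join is the topological closure
of the span. -/
structure PartialState (H : Type*) [NormedAddCommGroup H] [InnerProductSpace ℂ H]
    [CompleteSpace H] where
  toFun : Submodule ℂ H → ℝ
  nonneg : ∀ K : Submodule ℂ H, IsClosed (K : Set H) → 0 ≤ toFun K
  le_one : ∀ K : Submodule ℂ H, IsClosed (K : Set H) → toFun K ≤ 1
  map_bot : toFun ⊥ = 0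
  map_top_le : toFun ⊤ ≤ 1
  additive : ∀ A : ℕ → Submodule ℂ H, (∀ n, IsClosed ((A n : Set H))) →
    (∀ m n, m ≠ n → ∀ x ∈ A m, ∀ y ∈ A n, ⟪x, y⟫_ℂ = 0) →
    HasSum (fun n => toFun (A n)) (toFun (⨆ n, A n).topologicalClosure)

/-- Suprema commute with sums of nonnegative terms along a family that is directed upwards. -/
theorem hasSum_ciSup_of_directed {ι α : Type*} [Nonempty ι] {f : ι → α → ℝ} {b : ι → ℝ}
    (hf : ∀ i a, 0 ≤ f i a) (hbdd : ∀ a, BddAbove (Set.range fun i => f i a))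
    (hb : BddAbove (Set.range b)) (hdir : Directed (· ≤ ·) f)
    (hsum : ∀ i, HasSum (f i) (b i)) : HasSum (fun a => ⨆ i, f i a) (⨆ i, b i) := by
  refine hasSum_of_isLUB_of_nonneg _ (fun a => Real.iSup_nonneg fun i => hf i a) ⟨?_, ?_⟩
  · rintro _ ⟨s, rfl⟩
    let _ : Preorder ι := Preorder.lift f
    have : IsDirectedOrder ι := ⟨hdir⟩
    have hmono (a : α) : Monotone fun i => f i a := fun i j (hij : f i ≤ f j) => hij a
    exact le_of_tendsto'
      (tendsto_finsetSum s fun a _ => tendsto_atTop_ciSup (hmono a) (hbdd a))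
      fun i => (sum_le_hasSum s (fun a _ => hf i a) (hsum i)).trans (le_ciSup hb i)
  · intro c hc
    exact ciSup_le fun i => hasSum_le_of_sum_le (hsum i) fun s =>
      (Finset.sum_le_sum fun a _ => le_ciSup (hbdd a) i).trans (hc ⟨s, rfl⟩)

/-- the pointwise supremum of a directed family of partial states
is a partial state and is the least upper bound in the pointwise order; hence
the partial states form a directed complete partial order. -/
theorem stmt_2 {H : Type*} [NormedAddCommGroup H] [InnerProductSpace ℂ H] [CompleteSpace H]
    {I : Type*} [Nonempty I] (p : I → PartialState H)
    (hdir : ∀ i₁ i₂ : I, ∃ i₃ : I,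
      (∀ K : Submodule ℂ H, IsClosed (K : Set H) → (p i₁).toFun K ≤ (p i₃).toFun K) ∧
      (∀ K : Submodule ℂ H, IsClosed (K : Set H) → (p i₂).toFun K ≤ (p i₃).toFun K)) :
    ∃ q : PartialState H,
      (∀ K : Submodule ℂ H, IsClosed (K : Set H) → q.toFun K = ⨆ i, (p i).toFun K) ∧
      (∀ i : I, ∀ K : Submodule ℂ H, IsClosed (K : Set H) → (p i).toFun K ≤ q.toFun K) ∧
      (∀ q' : PartialState H,
        (∀ i : I, ∀ K : Submodule ℂ H, IsClosed (K : Set H) → (p i).toFun K ≤ q'.toFun K) →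
        ∀ K : Submodule ℂ H, IsClosed (K : Set H) → q.toFun K ≤ q'.toFun K) := by
  have hbdd (K : Submodule ℂ H) (hK : IsClosed (K : Set H)) :
      BddAbove (Set.range fun i => (p i).toFun K) := by
    refine ⟨1, ?_⟩
    rintro _ ⟨i, rfl⟩
    exact (p i).le_one K hK
  let q : PartialState H :=
    { toFun := fun K => ⨆ i, (p i).toFun K
      nonneg := fun K hK => Real.iSup_nonneg fun i => (p i).nonneg K hK
      le_one := fun K hK => ciSup_le fun i => (p i).le_one K hK
      map_bot := by simp [PartialState.map_bot]
      map_top_le := ciSup_le fun i => (p i).map_top_le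
      additive := fun A hA hort => by
        refine hasSum_ciSup_of_directed (fun i n => (p i).nonneg _ (hA n))
          (fun n => hbdd _ (hA n)) (hbdd _ (Submodule.isClosed_topologicalClosure _))
          (fun i j => ?_) fun i => (p i).additive A hA hort
        obtain ⟨k, hik, hjk⟩ := hdir i j
        exact ⟨k, fun n => hik _ (hA n), fun n => hjk _ (hA n)⟩ }
  exact ⟨q, fun _ _ => rfl, fun i K hK => le_ciSup (hbdd K hK) i,
    fun q' hq' K hK => ciSup_le fun i => hq' i K hK⟩
end

section
/- Let $H$ be a complex Hilbert space with a Hilbert (orthonormal) basis $(e_i)_{i\ge 0}$ indexed by the natural numbers, let $a \in [0,1]$, and let $(a_i)_{i\ge 0}$ be a binary expansion of $a$, i.e., $a_i \in \{0,1\}$ for all $i$ and $a = \sum_{i\ge 0} a_i/2^{i+1}$. Then there exists a partial state $p$ of the quantum logic of $H$ such that $p(\mathrm{span}\{e_i\}) = a_i/2^{i+1}$ for every $i$, $p(H) = a$, and for every finite subset $F$ of the natural numbers, $p(\mathrm{span}\{e_i : i \in F\})$ is a rational number. -/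
open scoped InnerProductSpace

namespace Submodule

variable {H : Type*} [NormedAddCommGroup H] [InnerProductSpace ℂ H] [CompleteSpace H]

/-- The squared norm of the orthogonal projection of `x` onto the closure of `K`. -/
noncomputable def projNormSq (K : Submodule ℂ H) (x : H) : ℝ :=
  ‖K.topologicalClosure.starProjection x‖ ^ 2

lemma projNormSq_nonneg (K : Submodule ℂ H) (x : H) : 0 ≤ K.projNormSq x :=
  sq_nonneg _

lemma projNormSq_le (K : Submodule ℂ H) (x : H) : K.projNormSq x ≤ ‖x‖ ^ 2 :=
  pow_le_pow_left₀ (norm_nonneg _) (norm_starProjection_apply_le _ x) 2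

lemma projNormSq_of_mem {K : Submodule ℂ H} {x : H} (hx : x ∈ K) :
    K.projNormSq x = ‖x‖ ^ 2 := by
  rw [projNormSq, starProjection_eq_self_iff.2 (K.le_topologicalClosure hx)]

lemma projNormSq_of_mem_orthogonal {K : Submodule ℂ H} {x : H} (hx : x ∈ Kᗮ) :
    K.projNormSq x = 0 := by
  rw [← orthogonal_closure] at hx
  simp [projNormSq, (starProjection_apply_eq_zero_iff _).2 hx]

/-- The squared norm of the projection is countably additive on orthogonal closed subspaces. -/
lemma hasSum_projNormSq (A : ℕ → Submodule ℂ H) (hc : ∀ n, IsClosed (A n : Set H))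
    (ho : ∀ m n, m ≠ n → ∀ x ∈ A m, ∀ y ∈ A n, ⟪x, y⟫_ℂ = 0) (x : H) :
    HasSum (fun n => (A n).projNormSq x) ((⨆ n, A n).topologicalClosure.projNormSq x) := by
  have hcl : ∀ n, (A n).topologicalClosure = A n := fun n =>
    (hc n).submodule_topologicalClosure_eq
  have hV : OrthogonalFamily ℂ (fun n => A n) fun n => (A n).subtypeₗᵢ := fun m n hmn v w =>
    ho m n hmn v v.2 w w.2
  set y : ℕ → H := fun n => (A n).topologicalClosure.starProjection x
  have hyA : ∀ n, y n ∈ A n := fun n =>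
    (hcl n).le ((A n).topologicalClosure.starProjection_apply_mem x)
  have hres : ∀ n, ∀ v ∈ A n, ⟪v, x - y n⟫_ℂ = 0 := fun n v hv =>
    (A n).topologicalClosure.sub_starProjection_mem_orthogonal x v
      ((A n).le_topologicalClosure hv)
  have hnorm : ∀ s : Finset ℕ, ‖∑ n ∈ s, y n‖ ^ 2 = ∑ n ∈ s, ‖y n‖ ^ 2 := fun s =>
    hV.norm_sum (fun n => ⟨y n, hyA n⟩) s
  have hinner : ∀ s : Finset ℕ, ⟪∑ n ∈ s, y n, x⟫_ℂ = (∑ n ∈ s, ‖y n‖ ^ 2 : ℝ) := fun s => by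
    rw [sum_inner, Complex.ofReal_sum]
    refine Finset.sum_congr rfl fun n _ => ?_
    have h := hres n (y n) (hyA n)
    rw [inner_sub_right, sub_eq_zero] at h
    rw [h, inner_self_eq_norm_sq_to_K]
    simp
  have hbessel : ∀ s : Finset ℕ, ∑ n ∈ s, ‖y n‖ ^ 2 ≤ ‖x‖ ^ 2 := fun s => by
    have h := norm_inner_le_norm (𝕜 := ℂ) (∑ n ∈ s, y n) x
    rw [hinner, Complex.norm_real, ← hnorm, norm_pow, norm_norm] at h
    rw [← hnorm]
    nlinarith [sq_nonneg (‖∑ n ∈ s, y n‖ - ‖x‖)]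
  have hsq : Summable fun n => ‖y n‖ ^ 2 :=
    summable_of_sum_le (fun _ => sq_nonneg _) hbessel
  have hsum : Summable y :=
    (hV.summable_iff_norm_sq_summable fun n => ⟨y n, hyA n⟩).2 hsq
  obtain ⟨z, hz⟩ := hsum
  have hzmem : z ∈ (⨆ n, A n).topologicalClosure :=
    mem_closure_of_tendsto hz <| Filter.Eventually.of_forall fun s =>
      sum_mem fun n _ => le_iSup A n (hyA n)
  have hzo : x - z ∈ (⨆ n, A n).topologicalClosureᗮ := by
    rw [orthogonal_closure, ← iInf_orthogonal, mem_iInf]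
    intro m v hv
    have h1 : HasSum (fun n => ⟪v, y n⟫_ℂ) ⟪v, z⟫_ℂ := hz.mapL (innerSL ℂ v)
    have h2 : HasSum (fun n => ⟪v, y n⟫_ℂ) ⟪v, y m⟫_ℂ :=
      hasSum_single m fun n hn => ho m n hn.symm v hv _ (hyA n)
    rw [inner_sub_right, h1.unique h2, ← inner_sub_right]
    exact hres m v hv
  have hproj : (⨆ n, A n).topologicalClosure.starProjection x = z :=
    eq_starProjection_of_mem_orthogonal hzmem hzo
  have hcc : (⨆ n, A n).topologicalClosure.topologicalClosure = (⨆ n, A n).topologicalClosure :=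
    (isClosed_topologicalClosure _).submodule_topologicalClosure_eq
  have hfin : (⨆ n, A n).topologicalClosure.projNormSq x = ‖z‖ ^ 2 := by
    rw [projNormSq, ← hproj]
    simp only [hcc]
  rw [hfin]
  have ht : Filter.Tendsto (fun s : Finset ℕ => ‖∑ n ∈ s, y n‖ ^ 2) Filter.atTop
      (nhds (‖z‖ ^ 2)) := (Filter.Tendsto.norm hz).pow 2
  simp only [hnorm] at ht
  exact ht

end Submodule

/-- The partial state with density operator diagonal in the orthonormal family `e`, with
eigenvalues `w`. -/
noncomputable def PartialState.diagonal {H : Type*} [NormedAddCommGroup H]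
    [InnerProductSpace ℂ H] [CompleteSpace H] {e : ℕ → H} (he : Orthonormal ℂ e)
    {w : ℕ → ℝ} (hw : ∀ i, 0 ≤ w i) (hs : Summable w) (hle : ∑' i, w i ≤ 1) :
    PartialState H :=
  have hbound (K : Submodule ℂ H) (i : ℕ) : w i * K.projNormSq (e i) ≤ w i :=
    mul_le_of_le_one_right (hw i) ((K.projNormSq_le (e i)).trans (by simp [he.1 i]))
  have hnonneg (K : Submodule ℂ H) (i : ℕ) : 0 ≤ w i * K.projNormSq (e i) :=
    mul_nonneg (hw i) (K.projNormSq_nonneg _)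
  have hsummable (K : Submodule ℂ H) : Summable fun i => w i * K.projNormSq (e i) :=
    hs.of_nonneg_of_le (hnonneg K) (hbound K)
  have hle_one (K : Submodule ℂ H) : ∑' i, w i * K.projNormSq (e i) ≤ 1 :=
    ((hsummable K).tsum_le_tsum (hbound K) hs).trans hle
  { toFun := fun K => ∑' i, w i * K.projNormSq (e i)
    nonneg := fun K _ => tsum_nonneg (hnonneg K)
    le_one := fun K _ => hle_one K
    map_bot := by
      simp [Submodule.projNormSq_of_mem_orthogonal]
    map_top_le := hle_one ⊤
    additive := fun A hc ho => by
      have hrow (i : ℕ) := (Submodule.hasSum_projNormSq A hc ho (e i)).mul_left (w i)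
      have hprod : Summable fun q : ℕ × ℕ => w q.1 * (A q.2).projNormSq (e q.1) := by
        refine (summable_prod_of_nonneg fun q => hnonneg _ _).2
          ⟨fun i => (hrow i).summable, ?_⟩
        simp only [(hrow _).tsum_eq]
        exact hsummable _
      have htotal := (hprod.hasSum.prod_fiberwise hrow).tsum_eq
      rw [htotal]
      exact ((Equiv.prodComm ℕ ℕ).hasSum_iff.2 hprod.hasSum).prod_fiberwise
        fun n => (hsummable (A n)).hasSum }

lemma PartialState.diagonal_toFun_span {H : Type*} [NormedAddCommGroup H]
    [InnerProductSpace ℂ H] [CompleteSpace H] {e : ℕ → H} (he : Orthonormal ℂ e)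
    {w : ℕ → ℝ} (hw : ∀ i, 0 ≤ w i) (hs : Summable w) (hle : ∑' i, w i ≤ 1) (F : Finset ℕ) :
    (diagonal he hw hs hle).toFun (Submodule.span ℂ (e '' ↑F)) = ∑ i ∈ F, w i := by
  change ∑' i, w i * (Submodule.span ℂ (e '' ↑F)).projNormSq (e i) = _
  rw [tsum_eq_sum (s := F)]
  · refine Finset.sum_congr rfl fun i hi => ?_
    rw [Submodule.projNormSq_of_mem (Submodule.subset_span (Set.mem_image_of_mem e hi)), he.1 i]
    simp
  · intro i hi
    rw [Submodule.projNormSq_of_mem_orthogonal, mul_zero]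
    have hle' : Submodule.span ℂ (e '' ↑F) ≤ (ℂ ∙ e i)ᗮ := by
      rw [Submodule.span_le]
      rintro _ ⟨j, hj, rfl⟩
      refine Submodule.mem_orthogonal_singleton_iff_inner_right.2 (he.2 ?_)
      rintro rfl
      exact hi hj
    exact fun v hv => Submodule.mem_orthogonal_singleton_iff_inner_left.1 (hle' hv)

lemma PartialState.diagonal_toFun_top {H : Type*} [NormedAddCommGroup H]
    [InnerProductSpace ℂ H] [CompleteSpace H] {e : ℕ → H} (he : Orthonormal ℂ e)
    {w : ℕ → ℝ} (hw : ∀ i, 0 ≤ w i) (hs : Summable w) (hle : ∑' i, w i ≤ 1) :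
    (diagonal he hw hs hle).toFun ⊤ = ∑' i, w i := by
  change ∑' i, w i * (⊤ : Submodule ℂ H).projNormSq (e i) = _
  simp [Submodule.projNormSq_of_mem, he.1]

/-- given an orthonormal (Hilbert) basis `(e i)` of `H` indexed by `ℕ`,
a number `a ∈ [0,1]` and a binary expansion `(d i)` of `a`, there is a partial
state `p` with `p (span {e i}) = d i / 2 ^ (i+1)`, `p H = a`, and `p` rational on
every subspace spanned by finitely many of the basis vectors. -/
theorem stmt_3 {H : Type*} [NormedAddCommGroup H] [InnerProductSpace ℂ H] [CompleteSpace H]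
    (e : HilbertBasis ℕ ℂ H) (a : ℝ) (ha : a ∈ Set.Icc (0 : ℝ) 1)
    (d : ℕ → ℝ) (hd : ∀ i, d i = 0 ∨ d i = 1)
    (hsum : HasSum (fun i => d i / 2 ^ (i + 1)) a) :
    ∃ p : PartialState H,
      (∀ i : ℕ, p.toFun (Submodule.span ℂ {e i}) = d i / 2 ^ (i + 1)) ∧
      p.toFun ⊤ = a ∧
      (∀ F : Finset ℕ, ∃ q : ℚ, p.toFun (Submodule.span ℂ ((fun i => e i) '' ↑F)) = (q : ℝ)) := by
  have hw : ∀ i, 0 ≤ d i / 2 ^ (i + 1) := fun i => by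
    rcases hd i with h | h <;> rw [h] <;> positivity
  have hle : ∑' i, d i / 2 ^ (i + 1) ≤ 1 := hsum.tsum_eq.trans_le ha.2
  have hspan := PartialState.diagonal_toFun_span e.orthonormal hw hsum.summable hle
  refine ⟨PartialState.diagonal e.orthonormal hw hsum.summable hle, fun i => ?_, ?_, fun F => ?_⟩
  · simpa using hspan {i}
  · exact (PartialState.diagonal_toFun_top _ _ _ _).trans hsum.tsum_eq
  · refine ⟨∑ i ∈ F, (if d i = 0 then 0 else 1) / 2 ^ (i + 1), (hspan F).trans ?_⟩
    push_cast
    refine Finset.sum_congr rfl fun i _ => ?_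
    rcases hd i with h | h <;> simp [h]
end

section
/- Let $H$ be a nontrivial finite-dimensional complex inner product space. Every directed family $(f_i)_{i\in I}$ of partial density operators on $H$ (directed with respect to the Loewner order) has a least upper bound in the set of partial density operators; i.e., there is a partial density operator $f$ with $f_i \le f$ for all $i$, and $f \le g$ for every partial density operator $g$ that is an upper bound of the family. Hence the partially ordered set of partial density operators on $H$ is directed complete. -/
open scoped InnerProductSpace

/-- An operator on a complex inner product space is positive if it is
self-adjoint (symmetric) and `⟪x, f x⟫ ≥ 0` for all `x`. -/
def IsPositiveOp {H : Type*} [NormedAddCommGroup H] [InnerProductSpace ℂ H]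
    (f : H →ₗ[ℂ] H) : Prop :=
  f.IsSymmetric ∧ ∀ x : H, 0 ≤ (⟪x, f x⟫_ℂ).re

/-- The Loewner order: `g ⊑ f` iff `f - g` is a positive operator. -/
def LoewnerLE {H : Type*} [NormedAddCommGroup H] [InnerProductSpace ℂ H]
    (g f : H →ₗ[ℂ] H) : Prop :=
  IsPositiveOp (f - g)

/-- A partial density operator: a positive operator with trace at most one. -/
def IsPartialDensityOp (H : Type*) [NormedAddCommGroup H] [InnerProductSpace ℂ H]
    [FiniteDimensional ℂ H] (f : H →ₗ[ℂ] H) : Prop :=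
  IsPositiveOp f ∧ (LinearMap.trace ℂ H f).re ≤ 1

open Filter Topology

theorem isPositiveOp_iff_isPositive {H : Type*} [NormedAddCommGroup H] [InnerProductSpace ℂ H]
    {f : H →ₗ[ℂ] H} : IsPositiveOp f ↔ f.IsPositive :=
  and_congr_right fun _ => forall_congr' fun x => by rw [inner_re_symm (𝕜 := ℂ)]; rfl

theorem loewnerLE_iff_le {H : Type*} [NormedAddCommGroup H] [InnerProductSpace ℂ H]
    {f g : H →ₗ[ℂ] H} : LoewnerLE g f ↔ g ≤ f :=
  isPositiveOp_iff_isPositive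

/-- The quadratic form of a positive operator is bounded by its trace on unit vectors. -/
theorem LinearMap.IsPositive.re_inner_le_re_trace {H : Type*} [NormedAddCommGroup H]
    [InnerProductSpace ℂ H] [FiniteDimensional ℂ H] {f : H →ₗ[ℂ] H} (hf : f.IsPositive)
    {x : H} (hx : ‖x‖ = 1) : (⟪f x, x⟫_ℂ).re ≤ (LinearMap.trace ℂ H f).re := by
  have hv : Orthonormal ℂ ((↑) : ({x} : Set H) → H) := by
    refine ⟨fun y => ?_, fun y z hyz => (hyz (Subsingleton.elim y z)).elim⟩
    rw [Set.mem_singleton_iff.mp y.2, hx]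
  obtain ⟨u, b, hvu, hb⟩ := hv.exists_orthonormalBasis_extension
  have hxu : x ∈ u := hvu rfl
  rw [f.trace_eq_sum_inner b, Complex.re_sum]
  refine le_of_eq_of_le ?_ (Finset.single_le_sum (f := fun i => (⟪b i, f (b i)⟫_ℂ).re)
    (fun i _ => hf.re_inner_nonneg_right (b i)) (Finset.mem_univ (⟨x, hxu⟩ : u)))
  simp only [hb]
  exact inner_re_symm (𝕜 := ℂ) _ _

theorem LinearMap.IsPositive.re_inner_le_re_trace_mul {H : Type*} [NormedAddCommGroup H]
    [InnerProductSpace ℂ H] [FiniteDimensional ℂ H] {f : H →ₗ[ℂ] H} (hf : f.IsPositive)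
    (x : H) : (⟪f x, x⟫_ℂ).re ≤ (LinearMap.trace ℂ H f).re * ‖x‖ ^ 2 := by
  rcases eq_or_ne x 0 with rfl | hx
  · simp
  have h := hf.re_inner_le_re_trace (norm_smul_inv_norm (𝕜 := ℂ) hx)
  have hx' : 0 < ‖x‖ := norm_pos_iff.mpr hx
  have e : (⟪f (((‖x‖ : ℂ)⁻¹) • x), ((‖x‖ : ℂ)⁻¹) • x⟫_ℂ).re = (⟪f x, x⟫_ℂ).re / ‖x‖ ^ 2 := by
    rw [map_smul, inner_smul_left, inner_smul_right, ← mul_assoc, ← Complex.ofReal_inv,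
      Complex.conj_ofReal, ← Complex.ofReal_mul, Complex.re_ofReal_mul]
    field_simp
  rw [← div_le_iff₀ (by positivity), ← e]
  exact h

/-- A monotone net of symmetric operators whose quadratic forms are bounded above converges
pointwise to a linear operator. -/
theorem exists_tendsto_of_monotone_of_bddAbove {H : Type*} [NormedAddCommGroup H]
    [InnerProductSpace ℂ H] [FiniteDimensional ℂ H] {I : Type*} [Preorder I] [Nonempty I]
    [IsDirectedOrder I] {f : I → H →ₗ[ℂ] H} (hf : Monotone f) (hsymm : ∀ i, (f i).IsSymmetric)
    (hbdd : ∀ x, BddAbove (Set.range fun i => (⟪f i x, x⟫_ℂ).re)) :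
    ∃ g : H →ₗ[ℂ] H, ∀ x, Tendsto (fun i => f i x) atTop (𝓝 (g x)) := by
  have hquad (x : H) : ∃ c, Tendsto (fun i => ⟪f i x, x⟫_ℂ) atTop (𝓝 c) := by
    have hmono : Monotone fun i => (⟪f i x, x⟫_ℂ).re := fun i j hij => by
      have h := (hf hij).re_inner_nonneg_left x
      rw [LinearMap.sub_apply, inner_sub_left, map_sub] at h
      exact sub_nonneg.mp h
    refine ⟨_, ((Complex.continuous_ofReal.tendsto _).comp
      (tendsto_atTop_ciSup hmono (hbdd x))).congr fun i => ?_⟩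
    exact (hsymm i).coe_re_inner_apply_self x
  choose q hq using hquad
  have hinner (x y : H) : ∃ c, Tendsto (fun i => ⟪x, f i y⟫_ℂ) atTop (𝓝 c) := by
    refine ⟨_, Tendsto.congr (fun i => ?_) (((((hq (y + x)).sub (hq (y - x))).add
      ((hq (y + Complex.I • x)).const_mul Complex.I)).sub
      ((hq (y - Complex.I • x)).const_mul Complex.I)).div_const 4)⟩
    rw [← hsymm i, inner_map_polarization (f i) y x]
  choose s hs using hinner
  let b := stdOrthonormalBasis ℂ H
  have hpt (x : H) : Tendsto (fun i => f i x) atTop (𝓝 (∑ k, s (b k) x • b k)) :=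
    (tendsto_finsetSum _ fun k _ => (hs (b k) x).smul_const (b k)).congr fun i =>
      b.sum_repr' (f i x)
  exact ⟨linearMapOfTendsto _ f (tendsto_pi_nhds.mpr hpt), hpt⟩

theorem LinearMap.IsPositive.of_tendsto {H : Type*} [NormedAddCommGroup H]
    [InnerProductSpace ℂ H] {I : Type*} {l : Filter I} [l.NeBot]
    {f : I → H →ₗ[ℂ] H} {g : H →ₗ[ℂ] H} (hf : ∀ᶠ i in l, (f i).IsPositive)
    (hg : ∀ x, Tendsto (fun i => f i x) l (𝓝 (g x))) : g.IsPositive := by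
  refine ⟨fun x y => ?_, fun x => ?_⟩
  · refine tendsto_nhds_unique_of_eventuallyEq ((hg x).inner tendsto_const_nhds)
      (tendsto_const_nhds.inner (hg y)) (hf.mono fun i hi => hi.1 x y)
  · exact ge_of_tendsto ((Complex.continuous_re.tendsto _).comp
      ((hg x).inner tendsto_const_nhds)) (hf.mono fun i hi => hi.2 x)

theorem LinearMap.tendsto_trace {H : Type*} [NormedAddCommGroup H]
    [InnerProductSpace ℂ H] [FiniteDimensional ℂ H] {I : Type*} {l : Filter I}
    {f : I → H →ₗ[ℂ] H} {g : H →ₗ[ℂ] H}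
    (hg : ∀ x, Tendsto (fun i => f i x) l (𝓝 (g x))) :
    Tendsto (fun i => LinearMap.trace ℂ H (f i)) l (𝓝 (LinearMap.trace ℂ H g)) := by
  simp only [LinearMap.trace_eq_sum_inner _ (stdOrthonormalBasis ℂ H)]
  exact tendsto_finsetSum _ fun k _ => tendsto_const_nhds.inner (hg _)

/-- every directed family of partial density operators on a
nontrivial finite-dimensional complex inner product space has a least upper
bound among the partial density operators; hence the poset of partial density
operators is directed complete. -/
theorem stmt_4 {H : Type*} [NormedAddCommGroup H] [InnerProductSpace ℂ H]
    [FiniteDimensional ℂ H] [Nontrivial H]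
    {I : Type*} [Nonempty I] (f : I → H →ₗ[ℂ] H)
    (hf : ∀ i, IsPartialDensityOp H (f i))
    (hdir : ∀ i₁ i₂ : I, ∃ i₃ : I, LoewnerLE (f i₁) (f i₃) ∧ LoewnerLE (f i₂) (f i₃)) :
    ∃ g : H →ₗ[ℂ] H, IsPartialDensityOp H g ∧ (∀ i, LoewnerLE (f i) g) ∧
      ∀ g' : H →ₗ[ℂ] H, IsPartialDensityOp H g' → (∀ i, LoewnerLE (f i) g') →
        LoewnerLE g g' := by
  simp only [loewnerLE_iff_le] at hdir ⊢
  have hpos (i : I) : (f i).IsPositive := isPositiveOp_iff_isPositive.mp (hf i).1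
  let _ : Preorder I := Preorder.lift f
  have : IsDirectedOrder I := ⟨hdir⟩
  have hmono : Monotone f := fun _ _ h => h
  obtain ⟨g, hg⟩ := exists_tendsto_of_monotone_of_bddAbove hmono (fun i => (hpos i).1)
    fun x => ⟨‖x‖ ^ 2, Set.forall_mem_range.mpr fun i =>
      ((hpos i).re_inner_le_re_trace_mul x).trans
        (mul_le_of_le_one_left (by positivity) (hf i).2)⟩
  refine ⟨g, ⟨isPositiveOp_iff_isPositive.mpr (.of_tendsto (.of_forall hpos) hg), ?_⟩,
    fun i => ?_, fun g' _ hg' => ?_⟩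
  · exact le_of_tendsto ((Complex.continuous_re.tendsto _).comp (LinearMap.tendsto_trace hg))
      (.of_forall fun i => (hf i).2)
  · exact LinearMap.IsPositive.of_tendsto (f := fun j => f j - f i)
      ((eventually_ge_atTop i).mono fun j hij => hmono hij) fun x => (hg x).sub_const _
  · exact LinearMap.IsPositive.of_tendsto (f := fun j => g' - f j)
      (.of_forall hg') fun x => (hg x).const_sub _
end

section
/- Let $m \le M$ be real numbers and let $\mu$ and $\nu$ be finite Borel measures on the real line, each with total mass at most $1$ and supported in the interval $[m,M]$ (i.e., $\mu(\mathbb{R}\setminus[m,M])=\nu(\mathbb{R}\setminus[m,M])=0$). If $\mu \le \nu$ (i.e., $\mu(A)\le\nu(A)$ for every Borel set $A$), then the closed interval $\left[\int t\,d\nu + m(1-\nu(\mathbb{R})),\; \int t\,d\nu + M(1-\nu(\mathbb{R}))\right]$ is contained in the closed interval $\left[\int t\,d\mu + m(1-\mu(\mathbb{R})),\; \int t\,d\mu + M(1-\mu(\mathbb{R}))\right]$. -/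
open MeasureTheory

/-- The identity is integrable for a finite measure on `ℝ` supported in a bounded interval. -/
theorem integrable_id_of_measure_compl_Icc_eq_zero {m M : ℝ} {μ : Measure ℝ} [IsFiniteMeasure μ]
    (hμ : μ (Set.Icc m M)ᶜ = 0) : Integrable (fun t : ℝ => t) μ :=
  Integrable.of_mem_Icc m M aemeasurable_id (mem_ae_iff.mpr hμ)

/-- if `μ ≤ ν` are subprobability Borel measures on `ℝ` supported
in `[m,M]`, then the expected-value interval of `ν` is contained in that of
`μ`, where the expected-value interval of a subprobability measure `θ` is
`[∫ t dθ + m(1-θ(ℝ)), ∫ t dθ + M(1-θ(ℝ))]`. -/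
theorem stmt_9 (m M : ℝ) (hmM : m ≤ M) (μ ν : Measure ℝ)
    (hμ1 : μ Set.univ ≤ 1) (hν1 : ν Set.univ ≤ 1)
    (hμs : μ (Set.Icc m M)ᶜ = 0) (hνs : ν (Set.Icc m M)ᶜ = 0)
    (hle : ∀ A : Set ℝ, MeasurableSet A → μ A ≤ ν A) :
    Set.Icc ((∫ t, t ∂ν) + m * (1 - (ν Set.univ).toReal))
        ((∫ t, t ∂ν) + M * (1 - (ν Set.univ).toReal)) ⊆
      Set.Icc ((∫ t, t ∂μ) + m * (1 - (μ Set.univ).toReal))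
        ((∫ t, t ∂μ) + M * (1 - (μ Set.univ).toReal)) := by
  have : IsFiniteMeasure μ := ⟨hμ1.trans_lt ENNReal.one_lt_top⟩
  have : IsFiniteMeasure ν := ⟨hν1.trans_lt ENNReal.one_lt_top⟩
  have hμν : μ ≤ ν := Measure.le_iff.mpr hle
  have hiμ := integrable_id_of_measure_compl_Icc_eq_zero hμs
  have hiν := integrable_id_of_measure_compl_Icc_eq_zero hνs
  have hν : ∀ᵐ t ∂ν, t ∈ Set.Icc m M := mem_ae_iff.mpr hνs
  have lower : ∫ t, (t - m) ∂μ ≤ ∫ t, (t - m) ∂ν :=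
    integral_mono_measure hμν (hν.mono fun t ht => sub_nonneg.mpr ht.1)
      (hiν.sub (integrable_const m))
  have upper : ∫ t, (M - t) ∂μ ≤ ∫ t, (M - t) ∂ν :=
    integral_mono_measure hμν (hν.mono fun t ht => sub_nonneg.mpr ht.2)
      ((integrable_const M).sub hiν)
  rw [integral_sub hiμ (integrable_const m), integral_sub hiν (integrable_const m)] at lower
  rw [integral_sub (integrable_const M) hiμ, integral_sub (integrable_const M) hiν] at upper
  simp only [integral_const, smul_eq_mul, measureReal_def] at lower upper
  exact Set.Icc_subset_Icc (by linarith) (by linarith)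
end

section
/- Let $\iota$ be a nonempty directed preordered index set, let $(\mu_i)_{i\in\iota}$ be a monotone family of finite Borel measures on the real line, and let $\mu$ be a finite Borel measure on the real line such that $\mu(A) = \sup_{i\in\iota} \mu_i(A)$ for every Borel set $A$. Then for every function $k : \mathbb{R} \to \mathbb{R}$ that is integrable with respect to $\mu$, the net $\left(\int k\,d\mu_i\right)_{i\in\iota}$ converges to $\int k\,d\mu$; that is, $\int k\,d\mu_i \to \int k\,d\mu$ along the atTop filter of $\iota$. -/
open MeasureTheory

/-- The Lebesgue integral commutes with a setwise supremum of a directed monotone family of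
measures. -/
theorem lintegral_eq_iSup_of_measure_eq_iSup {α ι : Type*} [MeasurableSpace α] [Preorder ι]
    [IsDirected ι (· ≤ ·)] {μs : ι → Measure α} {μ : Measure α} (hmono : Monotone μs)
    (hsup : ∀ A : Set α, MeasurableSet A → μ A = ⨆ i, μs i A)
    {f : α → ENNReal} (hf : Measurable f) :
    ∫⁻ x, f x ∂μ = ⨆ i, ∫⁻ x, f x ∂(μs i) := by
  refine Measurable.ennreal_induction
    (motive := fun f => ∫⁻ x, f x ∂μ = ⨆ i, ∫⁻ x, f x ∂(μs i)) ?_ ?_ ?_ hf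
  · intro c A hA
    simp only [lintegral_indicator_const hA, hsup A hA, ENNReal.mul_iSup]
  · intro f g _ hf _ hf_eq hg_eq
    simp only [Pi.add_apply, lintegral_add_left hf, hf_eq, hg_eq]
    refine ENNReal.iSup_add_iSup fun i j => ?_
    obtain ⟨l, hil, hjl⟩ := exists_ge_ge i j
    exact ⟨l, add_le_add (lintegral_mono' (hmono hil) le_rfl) (lintegral_mono' (hmono hjl) le_rfl)⟩
  · intro f hf hf_mono hf_eq
    simp only [lintegral_iSup hf hf_mono, hf_eq]
    exact iSup_comm

/-- Lebesgue integrals converge along a directed monotone family of measures with the given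
setwise supremum. -/
theorem tendsto_lintegral_of_measure_eq_iSup {α ι : Type*} [MeasurableSpace α] [Preorder ι]
    [IsDirected ι (· ≤ ·)] {μs : ι → Measure α} {μ : Measure α} (hmono : Monotone μs)
    (hsup : ∀ A : Set α, MeasurableSet A → μ A = ⨆ i, μs i A)
    {f : α → ENNReal} (hf : AEMeasurable f μ) :
    Filter.Tendsto (fun i => ∫⁻ x, f x ∂(μs i)) Filter.atTop (nhds (∫⁻ x, f x ∂μ)) := by
  have hle : ∀ i, μs i ≤ μ := fun i =>
    Measure.le_iff.2 fun A hA => (hsup A hA).symm ▸ le_iSup (fun j => μs j A) i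
  have hcongr : ∀ i, ∫⁻ x, f x ∂(μs i) = ∫⁻ x, hf.mk f x ∂(μs i) := fun i =>
    lintegral_congr_ae (Measure.absolutelyContinuous_of_le (hle i) |>.ae_le hf.ae_eq_mk)
  rw [lintegral_congr_ae hf.ae_eq_mk,
    lintegral_eq_iSup_of_measure_eq_iSup hmono hsup hf.measurable_mk]
  simp only [hcongr]
  exact tendsto_atTop_iSup fun i j hij => lintegral_mono' (hmono hij) le_rfl

/-- if `(μᵢ)` is a monotone family of finite Borel measures on
`ℝ` indexed by a nonempty directed preorder and `μ` is a finite Borel measure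
with `μ A = ⨆ i, μᵢ A` for every Borel set `A`, then for every `μ`-integrable
`k : ℝ → ℝ` the net `(∫ k dμᵢ)` converges to `∫ k dμ` along `atTop`. -/
theorem stmt_11 {ι : Type*} [Preorder ι] [Nonempty ι] [IsDirected ι (· ≤ ·)]
    (μs : ι → Measure ℝ) (hfin : ∀ i, IsFiniteMeasure (μs i))
    (hmono : ∀ i j : ι, i ≤ j → ∀ A : Set ℝ, MeasurableSet A → μs i A ≤ μs j A)
    (μ : Measure ℝ) [IsFiniteMeasure μ]
    (hsup : ∀ A : Set ℝ, MeasurableSet A → μ A = ⨆ i, μs i A)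
    (k : ℝ → ℝ) (hk : Integrable k μ) :
    Filter.Tendsto (fun i => ∫ x, k x ∂(μs i)) Filter.atTop (nhds (∫ x, k x ∂μ)) := by
  have hmono' : Monotone μs := fun i j hij => Measure.le_iff.2 (hmono i j hij)
  have hint : ∀ i, Integrable k (μs i) := fun i => hk.mono_measure <|
    Measure.le_iff.2 fun A hA => (hsup A hA).symm ▸ le_iSup (fun j => μs j A) i
  rw [integral_eq_lintegral_pos_part_sub_lintegral_neg_part hk]
  simp only [fun i => integral_eq_lintegral_pos_part_sub_lintegral_neg_part (hint i)]
  refine Filter.Tendsto.sub ?_ ?_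
  · exact (ENNReal.tendsto_toReal hk.lintegral_lt_top.ne).comp
      (tendsto_lintegral_of_measure_eq_iSup hmono' hsup hk.aemeasurable.ennreal_ofReal)
  · exact (ENNReal.tendsto_toReal hk.neg.lintegral_lt_top.ne).comp
      (tendsto_lintegral_of_measure_eq_iSup hmono' hsup hk.neg.aemeasurable.ennreal_ofReal)
end
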